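/- arXiv:1302.4637 — 4 statements merged into one kernel-verified Lean document; each statement's English description precedes it below -/
import Mathlib

section
/- Let ι be a countable type, A a rate matrix on ι, and j ∈ ι a fixed state. Then the matrix ψ is symmetric, and for every bounded function v : ι → ℝ its quadratic form satisfies ∑'_i ∑'_k (v i) · (ψ i k) · (v k) = ∑'_{i ≠ j} (v i − v j)² · A i j; in particular the quadratic form is nonnegative, so ψ is positive semidefinite. -/
/-- The product of a bounded function and a summable function is summable. -/
theorem summable_bounded_mul {ι : Type*} {a f : ι → ℝ} (ha : Summable a)
    (hf : ∃ C : ℝ, ∀ i, |f i| ≤ C) : Summable fun i => f i * a i := by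
  obtain ⟨C, hC⟩ := hf
  refine Summable.of_norm_bounded (ha.abs.mul_left C) fun i => ?_
  rw [Real.norm_eq_abs, abs_mul]
  exact mul_le_mul_of_nonneg_right (hC i) (abs_nonneg _)

/-- The iterated sum of the quadratic form of `diag a - a eⱼᵀ - eⱼ aᵀ` at a bounded function,
for a summable `a`. -/
theorem tsum_tsum_diag_sub_quadraticForm {ι : Type*} [DecidableEq ι] {a v : ι → ℝ} (j : ι)
    (ha : Summable a) (hv : ∃ C : ℝ, ∀ i, |v i| ≤ C) :
    ∑' i, ∑' k, v i * ((if i = k then a i else 0) - a i * (if k = j then (1 : ℝ) else 0)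
        - (if i = j then (1 : ℝ) else 0) * a k) * v k
      = (∑' i, (v i - v j) ^ 2 * a i) - v j ^ 2 * ∑' i, a i := by
  have hva := summable_bounded_mul ha hv
  have hvva := summable_bounded_mul hva hv
  have inner (i : ι) : ∑' k, v i * ((if i = k then a i else 0)
        - a i * (if k = j then (1 : ℝ) else 0) - (if i = j then (1 : ℝ) else 0) * a k) * v k
      = v i * (v i * a i) - v j * (v i * a i)
        - (if i = j then v j * ∑' k, v k * a k else 0) := by
    have h := ((hasSum_ite_eq i (v i * (v i * a i))).sub
      (hasSum_ite_eq j (v j * (v i * a i)))).sub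
      (hva.hasSum.mul_left (if i = j then v j else 0))
    rw [ite_mul, zero_mul] at h
    refine (h.congr_fun fun k => ?_).tsum_eq
    by_cases hik : i = k <;> by_cases hkj : k = j <;> by_cases hij : i = j <;>
      simp_all [eq_comm] <;> ring
  have outer := (hvva.hasSum.sub (hva.hasSum.mul_left (v j))).sub
    (hasSum_ite_eq j (v j * ∑' k, v k * a k))
  have square := (hvva.hasSum.sub (hva.hasSum.mul_left (2 * v j))).add
    (ha.hasSum.mul_left (v j ^ 2))
  rw [tsum_congr inner, outer.tsum_eq,
    tsum_congr fun i => show (v i - v j) ^ 2 * a i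
      = v i * (v i * a i) - 2 * v j * (v i * a i) + v j ^ 2 * a i by ring, square.tsum_eq]
  ring

/-- For a rate matrix `A` on a countable type `ι` and a fixed state `j`,
the matrix `ψ` with entries
`ψ i k = (if i = k then A i j else 0) - A i j * (if k = j then 1 else 0) - (if i = j then 1 else 0) * A k j`
is symmetric, and for every bounded `v : ι → ℝ` its quadratic form satisfies
`∑' i, ∑' k, v i * ψ i k * v k = ∑' (i : {i // i ≠ j}), (v i - v j)^2 * A i j`;
in particular the quadratic form is nonnegative, so `ψ` is positive semidefinite. -/
theorem stmt0 {ι : Type*} [Countable ι] [DecidableEq ι] (A : ι → ι → ℝ) (j : ι)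
    (hpos : ∀ i k : ι, i ≠ k → 0 ≤ A i k)
    (hsum : ∀ k : ι, Summable fun i => A i k)
    (hzero : ∀ k : ι, (∑' i, A i k) = 0)
    (hbd : ∃ C : ℝ, ∀ i k : ι, |A i k| ≤ C)
    (ψ : ι → ι → ℝ)
    (hψ : ∀ i k : ι, ψ i k =
      (if i = k then A i j else 0) - A i j * (if k = j then (1:ℝ) else 0)
        - (if i = j then (1:ℝ) else 0) * A k j)
    (v : ι → ℝ) (hv : ∃ C : ℝ, ∀ i : ι, |v i| ≤ C) :
    (∀ i k : ι, ψ i k = ψ k i) ∧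
    (∑' i, ∑' k, v i * ψ i k * v k
        = ∑' i : {i : ι // i ≠ j}, (v i.1 - v j) ^ 2 * A i.1 j) ∧
    0 ≤ ∑' i, ∑' k, v i * ψ i k * v k := by
  have hform : ∑' i, ∑' k, v i * ψ i k * v k
      = ∑' i : {i : ι // i ≠ j}, (v i.1 - v j) ^ 2 * A i.1 j := by
    simp only [hψ]
    rw [tsum_tsum_diag_sub_quadraticForm j (hsum j) hv, hzero, mul_zero, sub_zero]
    refine (tsum_subtype_eq_of_support_subset (s := {i | i ≠ j}) fun i hi hij => hi ?_).symm
    simp [hij]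
  refine ⟨fun i k => ?_, hform, hform ▸ tsum_nonneg fun i => ?_⟩
  · rw [hψ, hψ]
    by_cases hik : i = k
    · rw [hik]
    · rw [if_neg hik, if_neg (Ne.symm hik)]
      ring
  · exact mul_nonneg (sq_nonneg _) (hpos _ _ i.2)
end

section
/- Let ι be a countable type, A a rate matrix on ι, and j ∈ ι a fixed state. Then for every bounded function v : ι → ℝ, (∑'_i (v i) · A i j)² ≤ |A j j| · ‖v‖²_{M,j}, i.e. the linear map v ↦ ∑'_i (v i) · A i j is Lipschitz with respect to the seminorm ‖·‖_{M,j} with constant √|A j j|. -/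
/-- Weighted Cauchy–Schwarz inequality for series, with one of the functions constant. -/
theorem sq_tsum_mul_le_tsum_mul_tsum_sq_mul {ι : Type*} {a w : ι → ℝ} (ha : ∀ i, 0 ≤ a i)
    (h₀ : Summable a) (h₁ : Summable fun i => w i * a i) (h₂ : Summable fun i => w i ^ 2 * a i) :
    (∑' i, w i * a i) ^ 2 ≤ (∑' i, a i) * ∑' i, w i ^ 2 * a i := by
  have key (t : ℝ) : 0 ≤ (∑' i, a i) * (t * t) + (2 * ∑' i, w i * a i) * t
      + ∑' i, w i ^ 2 * a i := by
    have h := ((h₀.hasSum.mul_right (t * t)).add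
      ((h₁.hasSum.mul_left 2).mul_right t)).add h₂.hasSum
    refine h.nonneg fun i => ?_
    have := mul_nonneg (sq_nonneg (t + w i)) (ha i)
    linarith
  have := discrim_le_zero key
  rw [discrim] at this
  linarith

/-- For a rate matrix `A` on a countable type `ι`, a fixed state `j`, and
every bounded `v : ι → ℝ`, we have `(∑' i, v i * A i j)^2 ≤ |A j j| * ‖v‖²_{M,j}`, where
`‖v‖²_{M,j} := ∑' (i : {i // i ≠ j}), (v i - v j)^2 * A i j`; i.e. `v ↦ ∑' i, v i * A i j`
is Lipschitz with respect to the seminorm `‖·‖_{M,j}` with constant `√|A j j|`. -/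
theorem stmt1 {ι : Type*} [Countable ι] (A : ι → ι → ℝ) (j : ι)
    (hpos : ∀ i k : ι, i ≠ k → 0 ≤ A i k)
    (hsum : ∀ k : ι, Summable fun i => A i k)
    (hzero : ∀ k : ι, (∑' i, A i k) = 0)
    (hbd : ∃ C : ℝ, ∀ i k : ι, |A i k| ≤ C)
    (v : ι → ℝ) (hv : ∃ C : ℝ, ∀ i : ι, |v i| ≤ C) :
    (∑' i, v i * A i j) ^ 2
      ≤ |A j j| * ∑' i : {i : ι // i ≠ j}, (v i.1 - v j) ^ 2 * A i.1 j := by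
  obtain ⟨C, hC⟩ := hv
  have hA : HasSum (fun i => A i j) 0 := hzero j ▸ (hsum j).hasSum
  have bdd_mul {a u : ι → ℝ} {B : ℝ} (ha : Summable a) (hu : ∀ i, |u i| ≤ B) :
      Summable fun i => u i * a i := by
    refine Summable.of_norm_bounded (ha.abs.mul_left B) fun i => ?_
    rw [Real.norm_eq_abs, abs_mul]
    exact mul_le_mul_of_nonneg_right (hu i) (abs_nonneg _)
  classical
  set a : ι → ℝ := Function.update (fun i => A i j) j 0 with ha_def
  have ha_self : a j = 0 := by simp [ha_def]
  have ha_ne {i : ι} (hi : i ≠ j) : a i = A i j := by simp [ha_def, hi]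
  have ha_nonneg (i : ι) : 0 ≤ a i := by
    by_cases hi : i = j
    · rw [hi, ha_self]
    · rw [ha_ne hi]
      exact hpos i j hi
  have ha : HasSum a (-A j j) := by simpa using hA.update j 0
  have hw (i : ι) : |v i - v j| ≤ C + C := (abs_sub _ _).trans (add_le_add (hC i) (hC j))
  have hw_sq (i : ι) : |(v i - v j) ^ 2| ≤ (C + C) ^ 2 := by
    rw [abs_pow]
    exact pow_le_pow_left₀ (abs_nonneg _) (hw i) 2
  have h_linear : ∑' i, v i * A i j = ∑' i, (v i - v j) * a i := by
    have h := (bdd_mul (hsum j) hC).hasSum.sub (hA.mul_left (v j))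
    rw [mul_zero, sub_zero] at h
    rw [← h.tsum_eq]
    refine tsum_congr fun i => ?_
    by_cases hi : i = j
    · simp [hi]
    · rw [ha_ne hi, sub_mul]
  have h_quad : ∑' i : {i : ι // i ≠ j}, (v i.1 - v j) ^ 2 * A i.1 j
      = ∑' i, (v i - v j) ^ 2 * a i := by
    rw [← tsum_subtype_eq_of_support_subset (s := {i | i ≠ j})]
    · exact tsum_congr fun i => by rw [ha_ne i.2]
    · rintro i hi rfl
      exact hi (by simp)
  have h_diag : |A j j| = ∑' i, a i := by
    rw [ha.tsum_eq, abs_of_nonpos (neg_nonneg.mp (ha.nonneg ha_nonneg))]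
  rw [h_linear, h_quad, h_diag]
  exact sq_tsum_mul_le_tsum_mul_tsum_sq_mul ha_nonneg ha.summable
    (bdd_mul ha.summable hw) (bdd_mul ha.summable hw_sq)
end

section
/- Let ι be a countable type, A a rate matrix on ι, j ∈ ι a fixed state, a := A(·, j) the j-th column of A, and 0 < γ < 1. Let (f_u)_{u ∈ U} be a family of functions from the bounded functions ι → ℝ to ℝ such that for every u ∈ U and all bounded z, z' there exists λ_u(z,z') ∈ Λ_γ with f_u z − f_u z' = ∑'_i (z i − z' i) · (λ_u(z,z') i − a i). Assume g z := ⨆_{u ∈ U} f_u z is finite and the supremum is attained for every bounded z. Then g enjoys the same property: for all bounded z, z̄ there exists λ ∈ Λ_γ with g z − g z̄ = ∑'_i (z i − z̄ i) · (λ i − a i). -/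
/-- The zero-sum summable functions with `l i = d * a i` for some `d ∈ [c, C]` form a convex set. -/
lemma convex_balanced {ι : Type*} (a : ι → ℝ) (c C : ℝ) :
    Convex ℝ {l : ι → ℝ | Summable l ∧ (∑' i, l i) = 0 ∧
      ∀ i : ι, ∃ d ∈ Set.Icc c C, l i = d * a i} := by
  rintro l ⟨hl, hl0, hld⟩ m ⟨hm, hm0, hmd⟩ s t hs ht hst
  refine ⟨(hl.mul_left s).add (hm.mul_left t), ?_, fun i => ?_⟩
  · simp only [Pi.add_apply, Pi.smul_apply, smul_eq_mul]
    rw [(hl.mul_left s).tsum_add (hm.mul_left t), tsum_mul_left, tsum_mul_left, hl0, hm0]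
    simp
  · obtain ⟨d, hd, hld⟩ := hld i
    obtain ⟨e, he, hme⟩ := hmd i
    refine ⟨s * d + t * e, convex_Icc c C hd he hs ht hst, ?_⟩
    simp only [Pi.add_apply, Pi.smul_apply, smul_eq_mul, hld, hme]
    ring

lemma Summable.bounded_mul {ι : Type*} {w l : ι → ℝ} (hl : Summable l) {C : ℝ}
    (hw : ∀ i, |w i| ≤ C) : Summable fun i => w i * l i :=
  .of_norm_bounded (hl.abs.mul_left C) fun i => by
    rw [Real.norm_eq_abs, abs_mul]
    exact mul_le_mul_of_nonneg_right (hw i) (abs_nonneg _)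


/-- Let `A` be a rate matrix on a countable type `ι`, `j` a fixed state,
`a := A · j` its `j`-th column, and `0 < γ < 1`. If each member `f u` of a family of
drivers admits, for all bounded `z, z'`, some `l ∈ Λ_γ` with
`f u z - f u z' = ∑' i, (z i - z' i) * (l i - a i)`, and the (finite, attained) pointwise
supremum `g z := ⨆ u, f u z` exists for every bounded `z`, then `g` enjoys the same
property: for all bounded `z, z̄` there is `l ∈ Λ_γ` with
`g z - g z̄ = ∑' i, (z i - z̄ i) * (l i - a i)`. Here
`Λ_γ = {l | Summable l ∧ ∑' i, l i = 0 ∧ ∀ i, ∃ d ∈ [γ, γ⁻¹], l i = d * A i j}`. -/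
theorem stmt3 {ι : Type*} [Countable ι] {U : Type*} (A : ι → ι → ℝ) (j : ι)
    (hpos : ∀ i k : ι, i ≠ k → 0 ≤ A i k)
    (hsum : ∀ k : ι, Summable fun i => A i k)
    (hzero : ∀ k : ι, (∑' i, A i k) = 0)
    (hbd : ∃ C : ℝ, ∀ i k : ι, |A i k| ≤ C)
    (γ : ℝ) (hγ0 : 0 < γ) (hγ1 : γ < 1)
    (Λ : Set (ι → ℝ))
    (hΛ : Λ = {l : ι → ℝ | Summable l ∧ (∑' i, l i) = 0 ∧
      ∀ i : ι, ∃ d ∈ Set.Icc γ γ⁻¹, l i = d * A i j})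
    (f : U → (ι → ℝ) → ℝ)
    (hbal : ∀ (u : U) (z z' : ι → ℝ),
      (∃ Cz : ℝ, ∀ i, |z i| ≤ Cz) → (∃ Cz' : ℝ, ∀ i, |z' i| ≤ Cz') →
      ∃ l ∈ Λ, f u z - f u z' = ∑' i, (z i - z' i) * (l i - A i j))
    (hfinite : ∀ z : ι → ℝ, (∃ Cz : ℝ, ∀ i, |z i| ≤ Cz) →
      BddAbove (Set.range fun u => f u z))
    (hattained : ∀ z : ι → ℝ, (∃ Cz : ℝ, ∀ i, |z i| ≤ Cz) →
      ∃ u : U, f u z = ⨆ u' : U, f u' z) :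
    ∀ z zbar : ι → ℝ,
      (∃ Cz : ℝ, ∀ i, |z i| ≤ Cz) → (∃ Cz' : ℝ, ∀ i, |zbar i| ≤ Cz') →
      ∃ l ∈ Λ, (⨆ u : U, f u z) - (⨆ u : U, f u zbar)
        = ∑' i, (z i - zbar i) * (l i - A i j) := by
  intro z zbar hz hzbar
  obtain ⟨u, hu⟩ := hattained z hz
  obtain ⟨v, hv⟩ := hattained zbar hzbar
  obtain ⟨l, hl, hlu⟩ := hbal u z zbar hz hzbar
  obtain ⟨m, hm, hmv⟩ := hbal v z zbar hz hzbar
  have hu' : f u zbar ≤ ⨆ u : U, f u zbar := le_ciSup (hfinite zbar hzbar) u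
  have hv' : f v z ≤ ⨆ u : U, f u z := le_ciSup (hfinite z hz) v
  have hmem : (⨆ u : U, f u z) - (⨆ u : U, f u zbar) ∈
      Set.Icc (f v z - f v zbar) (f u z - f u zbar) := ⟨by linarith, by linarith⟩
  rw [← segment_eq_Icc (hmem.1.trans hmem.2)] at hmem
  obtain ⟨s, t, hs, ht, hst, hcomb⟩ := hmem
  have hconv : Convex ℝ Λ := hΛ ▸ convex_balanced (fun i => A i j) γ γ⁻¹
  refine ⟨s • m + t • l, hconv hm hl hs ht hst, ?_⟩
  obtain ⟨C, hC⟩ := hz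
  obtain ⟨C', hC'⟩ := hzbar
  have hsummable : ∀ k ∈ Λ, Summable fun i => (z i - zbar i) * (k i - A i j) := by
    intro k hk
    rw [hΛ] at hk
    exact (hk.1.sub (hsum j)).bounded_mul fun i =>
      (abs_sub _ _).trans (add_le_add (hC i) (hC' i))
  rw [← hcomb, hmv, hlu, smul_eq_mul, smul_eq_mul, ← tsum_mul_left, ← tsum_mul_left,
    ← ((hsummable m hm).mul_left s).tsum_add ((hsummable l hl).mul_left t)]
  refine tsum_congr fun i => ?_
  simp only [Pi.add_apply, Pi.smul_apply, smul_eq_mul]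
  linear_combination (-(z i - zbar i) * A i j) * hst
end

section
/- Let (Ω, F, μ) be a probability space with filtration {F_t}_{t ≥ 0}, and let τ : Ω → ℝ be a nonnegative random variable. Suppose there exist γ > 0 and ε > 0 such that e^{γτ} is integrable and for every t ≥ 0, μ[e^{γ(τ−t)^+} | F_t] ≤ 1 + ε almost everywhere, where (τ−t)^+ := max(τ − t, 0). Then for every β ≥ 0 there exists a constant k such that for all t ≥ 0, μ[(1+τ)^{1+β} | F_t] ≤ k · (1+t)^{1+β} almost everywhere. -/
open MeasureTheory

/-- A power of `1 + s` is dominated by an explicit multiple of the exponential `exp (γ * s)`. -/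
theorem one_add_rpow_le_mul_exp {γ p s : ℝ} (hγ : 0 < γ) (hp : 0 < p) (hs : 0 ≤ s) :
    (1 + s) ^ p ≤ (1 + p / γ) ^ p * Real.exp (γ * s) := by
  have hlin : 1 + s ≤ (1 + p / γ) * Real.exp (γ * s / p) := by
    have h := Real.add_one_le_exp (γ * s / p)
    have hpγ : 0 < p / γ := by positivity
    have hq : 0 ≤ γ * s / p := by positivity
    have hmul : p / γ * (γ * s / p) = s := by field_simp
    nlinarith
  calc (1 + s) ^ p ≤ ((1 + p / γ) * Real.exp (γ * s / p)) ^ p :=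
        Real.rpow_le_rpow (by positivity) hlin hp.le
    _ = (1 + p / γ) ^ p * Real.exp (γ * s) := by
        rw [Real.mul_rpow (by positivity) (Real.exp_pos _).le, ← Real.exp_mul,
          div_mul_cancel₀ _ hp.ne']

/-- A power of `1 + x` is dominated by the same power of `1 + t` times a multiple of the
exponential of the excess of `x` over `t`. -/
theorem one_add_rpow_le_mul_exp_max_sub {γ p t x : ℝ} (hγ : 0 < γ) (hp : 0 < p) (ht : 0 ≤ t)
    (hx : 0 ≤ x) :
    (1 + x) ^ p ≤ (1 + t) ^ p * (1 + p / γ) ^ p * Real.exp (γ * max (x - t) 0) := by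
  have hs : 0 ≤ max (x - t) 0 := le_max_right _ _
  have hle : 1 + x ≤ (1 + t) * (1 + max (x - t) 0) := by
    nlinarith [le_max_left (x - t) 0, mul_nonneg ht hs]
  calc (1 + x) ^ p ≤ ((1 + t) * (1 + max (x - t) 0)) ^ p :=
        Real.rpow_le_rpow (by positivity) hle hp.le
    _ = (1 + t) ^ p * (1 + max (x - t) 0) ^ p := Real.mul_rpow (by positivity) (by positivity)
    _ ≤ (1 + t) ^ p * ((1 + p / γ) ^ p * Real.exp (γ * max (x - t) 0)) :=
        mul_le_mul_of_nonneg_left (one_add_rpow_le_mul_exp hγ hp hs) (by positivity)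
    _ = _ := by ring

/-- Let `(Ω, F, μ)` be a probability space with filtration `ℱ`, and
`τ : Ω → ℝ` a nonnegative random variable. If there are `γ > 0` and `ε > 0` such that
`e^(γτ)` is integrable and for every `t ≥ 0`, `μ[e^(γ(τ-t)⁺) | ℱ t] ≤ 1 + ε` a.e., then
for every `β ≥ 0` there is a constant `k` with, for all `t ≥ 0`,
`μ[(1+τ)^(1+β) | ℱ t] ≤ k * (1+t)^(1+β)` a.e. -/
theorem stmt9 {Ω : Type*} {F : MeasurableSpace Ω} {μ : Measure Ω} [IsProbabilityMeasure μ]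
    (ℱ : Filtration ℝ F)
    (τ : Ω → ℝ) (hτmeas : Measurable τ) (hτ0 : ∀ ω, 0 ≤ τ ω)
    (γ ε : ℝ) (hγ : 0 < γ) (hε : 0 < ε)
    (hint : Integrable (fun ω => Real.exp (γ * τ ω)) μ)
    (hexp : ∀ t : ℝ, 0 ≤ t →
      ∀ᵐ ω ∂μ, (μ[fun ω => Real.exp (γ * max (τ ω - t) 0) | ℱ t]) ω ≤ 1 + ε) :
    ∀ β : ℝ, 0 ≤ β → ∃ k : ℝ, ∀ t : ℝ, 0 ≤ t →
      ∀ᵐ ω ∂μ, (μ[fun ω => (1 + τ ω) ^ (1 + β) | ℱ t]) ω ≤ k * (1 + t) ^ (1 + β) := by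
  intro β hβ
  have hp : 0 < 1 + β := by linarith
  refine ⟨(1 + (1 + β) / γ) ^ (1 + β) * (1 + ε), fun t ht => ?_⟩
  set C : ℝ := (1 + t) ^ (1 + β) * (1 + (1 + β) / γ) ^ (1 + β) with hC
  have hC0 : 0 ≤ C := by positivity
  have hexpInt : Integrable (fun ω => Real.exp (γ * max (τ ω - t) 0)) μ := by
    refine hint.mono' (by fun_prop) (ae_of_all _ fun ω => ?_)
    rw [Real.norm_eq_abs, Real.abs_exp, Real.exp_le_exp]
    exact mul_le_mul_of_nonneg_left (max_le (by linarith) (hτ0 ω)) hγ.le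
  have hbound (ω : Ω) :
      (1 + τ ω) ^ (1 + β) ≤ (C • fun ω => Real.exp (γ * max (τ ω - t) 0)) ω :=
    one_add_rpow_le_mul_exp_max_sub hγ hp ht (hτ0 ω)
  have hpowInt : Integrable (fun ω => (1 + τ ω) ^ (1 + β)) μ := by
    refine (hexpInt.smul C).mono' ((hτmeas.const_add 1).pow_const _).aestronglyMeasurable (ae_of_all _ fun ω => ?_)
    rw [Real.norm_of_nonneg (Real.rpow_nonneg (by linarith [hτ0 ω]) _)]
    exact hbound ω
  filter_upwards [condExp_mono (m := ℱ t) hpowInt (hexpInt.smul C) (ae_of_all _ hbound),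
    condExp_smul (μ := μ) C (fun ω => Real.exp (γ * max (τ ω - t) 0)) (ℱ t), hexp t ht]
    with ω hmono hsmul hle
  calc _ ≤ _ := hmono
    _ = C * (μ[fun ω => Real.exp (γ * max (τ ω - t) 0) | ℱ t]) ω := hsmul
    _ ≤ C * (1 + ε) := mul_le_mul_of_nonneg_left hle hC0
    _ = _ := by rw [hC]; ring
end
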